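/- Let S = R ∪ B be a bicolored point set in convex position with |R| = |B| = n ≥ 2. Then every Hamiltonian alternating cycle on S has at least n − r(S) crossings. -/

import Mathlib

open scoped Classical

noncomputable section

/-- Points of the plane. -/
abbrev Pt := ℝ × ℝ

/-- Orientation determinant of the ordered triple `(a, b, c)`. -/
def det2 (a b c : Pt) : ℝ :=
  (b.1 - a.1) * (c.2 - a.2) - (b.2 - a.2) * (c.1 - a.1)

/-- Two closed segments cross: some point lies in the relative interior of both. -/
def SegCross (e f : Pt × Pt) : Prop :=
  ∃ x : Pt, x ∈ openSegment ℝ e.1 e.2 ∧ x ∈ openSegment ℝ f.1 f.2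

/-- Number of crossings (unordered pairs of crossing edges) among a list of edges. -/
def crossNum (es : List (Pt × Pt)) : ℕ :=
  ((Finset.range es.length ×ˢ Finset.range es.length).filter
    (fun ij => ij.1 < ij.2 ∧
      SegCross (es.getD ij.1 ((0, 0), (0, 0))) (es.getD ij.2 ((0, 0), (0, 0))))).card

/-- Number of other edges crossing the `i`-th edge of the list. -/
def edgeCrossCount (es : List (Pt × Pt)) (i : ℕ) : ℕ :=
  ((Finset.range es.length).filter (fun j => j ≠ i ∧
      SegCross (es.getD i ((0, 0), (0, 0))) (es.getD j ((0, 0), (0, 0))))).card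

/-- Every edge is crossed by at most one other edge. -/
def OnePlane (es : List (Pt × Pt)) : Prop :=
  ∀ i ∈ Finset.range es.length, edgeCrossCount es i ≤ 1

/-- The edges of a path given by its list of vertices. -/
def pathEdges (l : List Pt) : List (Pt × Pt) := l.zip l.tail

/-- The edges of a cycle given by its list of vertices (including the wrap-around edge). -/
def cycleEdges (l : List Pt) : List (Pt × Pt) := l.zip (l.rotate 1)

/-- An edge joining a point of `R` to a point of `B`. -/
def Bichromatic (R B : Finset Pt) (e : Pt × Pt) : Prop :=
  (e.1 ∈ R ∧ e.2 ∈ B) ∨ (e.1 ∈ B ∧ e.2 ∈ R)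

/-- A Hamiltonian alternating path on the bicolored point set `R ∪ B`
with endpoints `p` and `q`. -/
structure HamAltPath (R B : Finset Pt) (p q : Pt) where
  verts : List Pt
  nodup : verts.Nodup
  cover : verts.toFinset = R ∪ B
  head_eq : verts.head? = some p
  last_eq : verts.getLast? = some q
  alt : ∀ e ∈ pathEdges verts, Bichromatic R B e

/-- A Hamiltonian alternating cycle on the bicolored point set `R ∪ B`. -/
structure HamAltCycle (R B : Finset Pt) where
  verts : List Pt
  nodup : verts.Nodup
  cover : verts.toFinset = R ∪ B
  alt : ∀ e ∈ cycleEdges verts, Bichromatic R B e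

/-- A Hamiltonian alternating path with prescribed endpoints is optimum if it has the
minimum number of crossings among all such paths. -/
def OptimumPath (R B : Finset Pt) (p q : Pt) (P : HamAltPath R B p q) : Prop :=
  ∀ Q : HamAltPath R B p q, crossNum (pathEdges P.verts) ≤ crossNum (pathEdges Q.verts)

/-- No three points of `S` are collinear. -/
def GeneralPosition (S : Finset Pt) : Prop :=
  ∀ p ∈ S, ∀ q ∈ S, ∀ r ∈ S, p ≠ q → p ≠ r → q ≠ r → ¬ Collinear ℝ ({p, q, r} : Set Pt)

/-- Every point of `S` is a vertex (extreme point) of its convex hull. -/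
def ConvexPosition (S : Finset Pt) : Prop :=
  ∀ p ∈ S, p ∉ convexHull ℝ ((S.erase p : Finset Pt) : Set Pt)

/-- The points of `S` lying on the boundary of the convex hull of `S`
(i.e. the extreme points of `S`). -/
def hullPts (S : Finset Pt) : Finset Pt :=
  S.filter fun p => p ∉ convexHull ℝ ((S.erase p : Finset Pt) : Set Pt)

/-- Cyclic successor on `Fin m`. -/
def cycSucc {m : ℕ} (hm : 0 < m) (i : Fin m) : Fin m :=
  ⟨(i.val + 1) % m, Nat.mod_lt _ hm⟩

/-- Cyclic predecessor on `Fin m`. -/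
def cycPred {m : ℕ} (hm : 0 < m) (i : Fin m) : Fin m :=
  ⟨(i.val + (m - 1)) % m, Nat.mod_lt _ hm⟩

/-- `pt` lists points in convex position, in clockwise circular order:
every index-increasing triple is clockwise oriented. -/
def CWList {m : ℕ} (pt : Fin m → Pt) : Prop :=
  Function.Injective pt ∧
    ∀ i j k : Fin m, i < j → j < k → det2 (pt i) (pt j) (pt k) < 0

/-- `pt` is a clockwise listing of the points of `S` on the boundary of `CH(S)`. -/
def IsHullList (S : Finset Pt) {m : ℕ} (pt : Fin m → Pt) : Prop :=
  CWList pt ∧ Finset.univ.image pt = hullPts S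

/-- The number of runs of color `A` (with other color `C`) in the cyclic sequence `pt`:
a run starts at an `A`-point whose cyclic predecessor is a `C`-point; a completely
`A`-colored cycle forms a single run. -/
def runCount {m : ℕ} (hm : 0 < m) (A C : Finset Pt) (pt : Fin m → Pt) : ℕ :=
  if ∀ i : Fin m, pt i ∈ A then 1
  else (Finset.univ.filter fun i : Fin m => pt i ∈ A ∧ pt (cycPred hm i) ∈ C).card

/-- `q` is the counterclockwise radial order of the points of `T` around `r`. -/
def CCWOrder (r : Pt) {k : ℕ} (q : Fin k → Pt) (T : Finset Pt) : Prop :=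
  Function.Injective q ∧ Finset.univ.image q = T ∧
    ∀ i j : Fin k, i < j → 0 < det2 r (q i) (q j)

/-- `q` is the clockwise radial order of the points of `T` around `r`. -/
def CWOrder (r : Pt) {k : ℕ} (q : Fin k → Pt) (T : Finset Pt) : Prop :=
  Function.Injective q ∧ Finset.univ.image q = T ∧
    ∀ i j : Fin k, i < j → det2 r (q i) (q j) < 0

/-- Counting one extra point of color `A` (the center), the initial segment
`q 0, …, q j` contains equally many points of color `A` and of color `C`. -/
def BalancedAt (A C : Finset Pt) {k : ℕ} (q : Fin k → Pt) (j : Fin k) : Prop :=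
  1 + (Finset.univ.filter fun i : Fin k => i ≤ j ∧ q i ∈ A).card
    = (Finset.univ.filter fun i : Fin k => i ≤ j ∧ q i ∈ C).card

/-- `j` is the first balanced index of the sequence `q`. -/
def FirstBalanced (A C : Finset Pt) {k : ℕ} (q : Fin k → Pt) (j : Fin k) : Prop :=
  BalancedAt A C q j ∧ ∀ j' : Fin k, j' < j → ¬ BalancedAt A C q j'

/-- The triple `(R ∪ B, r, b)` is a special configuration (Definition 2.2):
(i) both neighbors of `r` on the hull boundary are red and both neighbors of `b` are
blue; (ii) in the counterclockwise and clockwise radial orders around `r`, the first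
balanced point is `b`; (iii) symmetrically around `b`, the first balanced point is `r`. -/
def SpecialConfig (R B : Finset Pt) (r b : Pt) : Prop :=
  r ∈ hullPts (R ∪ B) ∧ b ∈ hullPts (R ∪ B) ∧
  (∀ (m : ℕ) (hm : 0 < m) (pt : Fin m → Pt), IsHullList (R ∪ B) pt →
    ∀ i : Fin m,
      (pt i = r → pt (cycPred hm i) ∈ R ∧ pt (cycSucc hm i) ∈ R) ∧
      (pt i = b → pt (cycPred hm i) ∈ B ∧ pt (cycSucc hm i) ∈ B)) ∧
  (∀ (k : ℕ) (q : Fin k → Pt),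
      (CCWOrder r q ((R ∪ B).erase r) ∨ CWOrder r q ((R ∪ B).erase r)) →
      ∀ j : Fin k, FirstBalanced R B q j → q j = b) ∧
  (∀ (k : ℕ) (q : Fin k → Pt),
      (CCWOrder b q ((R ∪ B).erase b) ∨ CWOrder b q ((R ∪ B).erase b)) →
      ∀ j : Fin k, FirstBalanced B R q j → q j = r)

/-- The unordered pair `{a, b}` occurs as an edge of the list `es`. -/
def IsEdgeOf (es : List (Pt × Pt)) (a b : Pt) : Prop := (a, b) ∈ es ∨ (b, a) ∈ es

/-- The clockwise cyclic interval of indices from `a` to `b`, inclusive. -/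
def cycIdx {m : ℕ} (hm : 0 < m) (a b : Fin m) : Finset (Fin m) :=
  (Finset.range ((b.val + m - a.val) % m + 1)).image
    fun t => (⟨(a.val + t) % m, Nat.mod_lt _ hm⟩ : Fin m)


/-- The chords with endpoints `a, b` and `c, d` interlace. -/
def Interlaced (a b c d : ℕ) : Prop :=
  (min a b < c ∧ c < max a b ∧ (d < min a b ∨ max a b < d)) ∨
    (min a b < d ∧ d < max a b ∧ (c < min a b ∨ max a b < c))

/-- The functions that take the same value at both endpoints of every edge. -/
def edgeConst {m : ℕ} {E : Type*} (r b : E → Fin m) : Submodule ℚ (Fin m → ℚ) where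
  carrier := {h | ∀ e, h (r e) = h (b e)}
  add_mem' := fun hf hg e => by simp only [Pi.add_apply, hf e, hg e]
  zero_mem' := fun _ => rfl
  smul_mem' := fun c f hf e => by simp only [Pi.smul_apply, hf e]

/-- The number of ordered pairs of interlacing edges. -/
def crossPairs {m : ℕ} {E : Type*} [Fintype E] (r b : E → Fin m) : ℕ :=
  ∑ e, ∑ f, if Interlaced (r e) (b e) (r f) (b f) then 1 else 0

theorem Interlaced.symm {a b c d : ℕ} (h : Interlaced a b c d) : Interlaced c d a b := by
  unfold Interlaced at *
  omega

theorem interlaced_comm {a b c d : ℕ} : Interlaced a b c d ↔ Interlaced c d a b :=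
  ⟨Interlaced.symm, Interlaced.symm⟩

theorem interlaced_swap {a b c d : ℕ} : Interlaced a b c d ↔ Interlaced b a d c := by
  unfold Interlaced
  omega

theorem not_interlaced_self (a b : ℕ) : ¬ Interlaced a b a b := by
  unfold Interlaced
  omega

/-- A chord meets two opposite sides of a convex quadrilateral at most as often as it meets
the two diagonals. -/
theorem interlaced_sides_le {a b c d x y : ℕ} (h : Interlaced a b c d) :
    (if Interlaced x y a d then 1 else 0) + (if Interlaced x y c b then 1 else 0) ≤
      (if Interlaced x y a b then 1 else 0) + (if Interlaced x y c d then 1 else 0) := by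
  have h₁ : Interlaced x y a d → Interlaced x y a b ∨ Interlaced x y c d := by
    unfold Interlaced at *; omega
  have h₂ : Interlaced x y c b → Interlaced x y a b ∨ Interlaced x y c d := by
    unfold Interlaced at *; omega
  have h₃ : Interlaced x y a d → Interlaced x y c b →
      Interlaced x y a b ∧ Interlaced x y c d := by
    unfold Interlaced at *; omega
  split_ifs <;> first | omega | tauto

theorem sum_eq_add_add_sum_erase {E : Type*} [Fintype E] {e₁ e₂ : E} (h : e₁ ≠ e₂)
    (F : E → ℕ) : ∑ e, F e = F e₁ + F e₂ + ∑ e ∈ (Finset.univ.erase e₁).erase e₂, F e := by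
  rw [← Finset.add_sum_erase _ F (Finset.mem_univ e₁),
    ← Finset.add_sum_erase (Finset.univ.erase e₁) F (a := e₂) (by simp [h.symm]), add_assoc]

/-- Exchanging the blue endpoints of two interlacing edges removes at least one crossing. -/
theorem crossPairs_comp_swap {m : ℕ} {E : Type*} [Fintype E] (r b : E → Fin m) {e₁ e₂ : E}
    (h : Interlaced (r e₁) (b e₁) (r e₂) (b e₂)) :
    crossPairs r (b ∘ Equiv.swap e₁ e₂) + 2 ≤ crossPairs r b := by
  have hne : e₁ ≠ e₂ := by
    rintro rfl
    exact not_interlaced_self _ _ h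
  unfold crossPairs
  simp only [sum_eq_add_add_sum_erase hne, Finset.sum_add_distrib, Function.comp_apply,
    Equiv.swap_apply_left, Equiv.swap_apply_right]
  set T := (Finset.univ.erase e₁).erase e₂
  have hT : ∀ f ∈ T, Equiv.swap e₁ e₂ f = f := fun f hf => by
    simp only [T, Finset.mem_erase] at hf
    exact Equiv.swap_apply_of_ne_of_ne hf.2.1 hf.1
  have h₁ : (∑ f ∈ T, if Interlaced (r f) (b (Equiv.swap e₁ e₂ f)) (r e₁) (b e₂) then 1 else 0) +
      (∑ f ∈ T, if Interlaced (r f) (b (Equiv.swap e₁ e₂ f)) (r e₂) (b e₁) then 1 else 0) ≤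
      (∑ f ∈ T, if Interlaced (r f) (b f) (r e₁) (b e₁) then 1 else 0) +
      (∑ f ∈ T, if Interlaced (r f) (b f) (r e₂) (b e₂) then 1 else 0) := by
    rw [← Finset.sum_add_distrib, ← Finset.sum_add_distrib]
    refine Finset.sum_le_sum fun f hf => ?_
    rw [hT f hf]
    exact interlaced_sides_le h
  have h₂ : (∑ f ∈ T, if Interlaced (r e₁) (b e₂) (r f) (b (Equiv.swap e₁ e₂ f)) then 1 else 0) +
      (∑ f ∈ T, if Interlaced (r e₂) (b e₁) (r f) (b (Equiv.swap e₁ e₂ f)) then 1 else 0) ≤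
      (∑ f ∈ T, if Interlaced (r e₁) (b e₁) (r f) (b f) then 1 else 0) +
      (∑ f ∈ T, if Interlaced (r e₂) (b e₂) (r f) (b f) then 1 else 0) := by
    simpa only [interlaced_comm] using h₁
  have h₃ : (∑ f ∈ T, ∑ g ∈ T, if Interlaced (r f) (b (Equiv.swap e₁ e₂ f))
        (r g) (b (Equiv.swap e₁ e₂ g)) then 1 else 0) =
      ∑ f ∈ T, ∑ g ∈ T, if Interlaced (r f) (b f) (r g) (b g) then 1 else 0 :=
    Finset.sum_congr rfl fun f hf => Finset.sum_congr rfl fun g hg => by rw [hT f hf, hT g hg]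
  have h₄ : ¬ Interlaced (r e₁) (b e₂) (r e₂) (b e₁) := by
    unfold Interlaced at *; omega
  rw [h₃, if_pos h, if_pos h.symm, if_neg h₄, if_neg (mt Interlaced.symm h₄),
    if_neg (not_interlaced_self _ _), if_neg (not_interlaced_self _ _),
    if_neg (not_interlaced_self _ _), if_neg (not_interlaced_self _ _)]
  omega

theorem finrank_edgeConst_comp_swap_le {m : ℕ} {E : Type*} (r b : E → Fin m) (e₁ e₂ : E) :
    Module.finrank ℚ (edgeConst r (b ∘ Equiv.swap e₁ e₂)) ≤
      Module.finrank ℚ (edgeConst r b) + 1 := by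
  set K' := edgeConst r (b ∘ Equiv.swap e₁ e₂)
  let φ : K' →ₗ[ℚ] ℚ :=
    (LinearMap.proj (R := ℚ) (φ := fun _ : Fin m => ℚ) (r e₁) - LinearMap.proj (b e₁)) ∘ₗ
      K'.subtype
  have hker : (LinearMap.ker φ).map K'.subtype ≤ edgeConst r b := by
    rintro _ ⟨⟨h, hh⟩, hφ, rfl⟩ e
    have h₀ : h (r e₁) = h (b e₁) := sub_eq_zero.1 hφ
    have h₁ := hh e₁
    have h₂ := hh e₂
    have h₃ := hh e
    simp only [Function.comp_apply, Equiv.swap_apply_left, Equiv.swap_apply_right] at h₁ h₂ h₃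
    change h (r e) = h (b e)
    by_cases he₁ : e = e₁
    · rw [he₁, h₀]
    by_cases he₂ : e = e₂
    · rw [he₂, h₂, ← h₁, h₀]
    rwa [Equiv.swap_apply_of_ne_of_ne he₁ he₂] at h₃
  have h₁ := LinearMap.finrank_range_add_finrank_ker φ
  have h₂ := Submodule.finrank_mono hker
  rw [Submodule.finrank_map_subtype_eq] at h₂
  have h₃ := Submodule.finrank_le (LinearMap.range φ)
  rw [Module.finrank_self] at h₃
  omega

/-- If all degrees are even, no vertex set has exactly one boundary edge. -/
theorem mem_iff_mem_of_even {m : ℕ} {E : Type*} [Fintype E] {r b : E → Fin m}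
    (hr : ∀ v, Even (Finset.univ.filter fun e => r e = v).card)
    (hb : ∀ v, Even (Finset.univ.filter fun e => b e = v).card)
    (I : Finset (Fin m)) {e₁ : E} (h : ∀ e, e ≠ e₁ → (r e ∈ I ↔ b e ∈ I)) :
    r e₁ ∈ I ↔ b e₁ ∈ I := by
  have key : ∀ u : E → Fin m, (∀ v, Even (Finset.univ.filter fun e => u e = v).card) →
      Even (Finset.univ.filter fun e => u e ∈ I).card := by
    intro u hu
    rw [Finset.card_eq_sum_card_fiberwise (f := u) (t := I) (by intro e; simp)]
    refine Finset.even_sum _ fun v hv => ?_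
    have hv' : ((Finset.univ.filter fun e => u e ∈ I).filter fun e => u e = v) =
        Finset.univ.filter fun e => u e = v := by
      ext e
      simp only [Finset.mem_filter, Finset.mem_univ, true_and, and_iff_right_iff_imp]
      rintro rfl
      exact hv
    rw [hv']
    exact hu v
  have aux : ∀ u w : E → Fin m, (∀ e, e ≠ e₁ → (u e ∈ I ↔ w e ∈ I)) → u e₁ ∈ I → w e₁ ∉ I →
      (Finset.univ.filter fun e => u e ∈ I).card =
        (Finset.univ.filter fun e => w e ∈ I).card + 1 := by
    intro u w h hu hw
    rw [← Finset.card_insert_of_notMem (a := e₁) (by simpa using hw)]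
    congr 1
    ext e
    by_cases he : e = e₁
    · simp [he, hu]
    · simp [he, h e he]
  have h₁ := key r hr
  have h₂ := key b hb
  by_contra hc
  by_cases h₃ : r e₁ ∈ I
  · rw [aux r b h h₃ (by tauto)] at h₁
    exact (Nat.not_even_iff_odd.2 h₂.add_one) h₁
  · rw [aux b r (fun e he => (h e he).symm) (by tauto) h₃] at h₂
    exact (Nat.not_even_iff_odd.2 h₁.add_one) h₂

/-- No edge leaves the interval `[x, y]`. -/
def IsClosedIcc {m : ℕ} {E : Type*} (r b : E → Fin m) (x y : Fin m) : Prop :=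
  x ≤ y ∧ ∀ e, r e ∈ Finset.Icc x y ↔ b e ∈ Finset.Icc x y

/-- In a plane 2-regular bipartite geometric graph on points in convex position, two consecutive
vertices of the same color are separated by an invariant interval. -/
theorem exists_isClosedIcc {m : ℕ} {E : Type*} [Fintype E] {r b : E → Fin m}
    (hplane : ∀ e f, ¬ Interlaced (r e) (b e) (r f) (b f))
    (hcol : ∀ e f, r e ≠ b f)
    (hr : ∀ v, Even (Finset.univ.filter fun e => r e = v).card)
    (hb : ∀ e, (Finset.univ.filter fun f => b f = b e).card = 2)
    {i j : Fin m} (hij : (i : ℕ) + 1 = j) (hi : ∃ e, r e = i) (hj : ∀ e, b e ≠ j) :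
    (∃ x, IsClosedIcc r b x i) ∨ ∃ y, IsClosedIcc r b j y := by
  have hb' : ∀ v, Even (Finset.univ.filter fun e => b e = v).card := by
    intro v
    by_cases hv : ∃ e, b e = v
    · obtain ⟨e, rfl⟩ := hv
      simp [hb]
    · push Not at hv
      simp [hv]
  have hpartner : ∀ e, ∃ f, ∀ g, g ≠ f → b g = b e → g = e := by
    intro e
    have he : e ∈ Finset.univ.filter fun f => b f = b e := by simp
    have hc := Finset.card_erase_of_mem he
    rw [hb] at hc
    obtain ⟨f, hf⟩ := Finset.card_eq_one.1 hc
    refine ⟨f, fun g hg hge => ?_⟩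
    by_contra hne
    have : g ∈ (Finset.univ.filter fun f => b f = b e).erase e := by simp [hne, hge]
    rw [hf, Finset.mem_singleton] at this
    exact hg this
  have hclosed : ∀ (x y : Fin m) (e₁ : E), x ≤ y →
      (∀ e, e ≠ e₁ → (r e ∈ Finset.Icc x y ↔ b e ∈ Finset.Icc x y)) → IsClosedIcc r b x y := by
    refine fun x y e₁ hxy h => ⟨hxy, fun e => ?_⟩
    by_cases he : e = e₁
    · rw [he]
      exact mem_iff_mem_of_even hr hb' _ h
    · exact h e he
  by_cases hright : ∃ e, r e = i ∧ i < b e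
  · right
    obtain ⟨e₀, he₀, hmin⟩ := Finset.exists_min_image
      (Finset.univ.filter fun e => r e = i ∧ i < b e) b (by
        obtain ⟨e, he⟩ := hright
        exact ⟨e, by simpa using he⟩)
    simp only [Finset.mem_filter, Finset.mem_univ, true_and] at he₀ hmin
    obtain ⟨e₁, he₁⟩ := hpartner e₀
    have h₀ := he₀.2
    have hj₀ := hj e₀
    rw [Fin.lt_def] at h₀
    rw [Ne, Fin.ext_iff] at hj₀
    refine ⟨⟨b e₀ - 1, by omega⟩, hclosed _ _ e₁ (by rw [Fin.le_def]; simp only; omega) ?_⟩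
    intro e he
    simp only [Finset.mem_Icc, Fin.le_def]
    by_cases hee : e = e₀
    · rw [hee, he₀.1]
      omega
    have h₁ : b e ≠ b e₀ := fun h => hee (he₁ e he h)
    have h₂ := hcol e e₀
    have h₃ := hcol e₀ e
    have h₄ := hmin e
    have h₅ := hplane e₀ e
    unfold Interlaced at h₅
    rw [he₀.1] at h₃ h₅
    simp only [Ne, Fin.ext_iff, Fin.lt_def, Fin.le_def] at h₁ h₂ h₃ h₄
    by_cases h₆ : (r e : ℕ) = i
    · omega
    · clear h₄
      omega
  · left
    push Not at hright
    obtain ⟨e₀, he₀, hmin⟩ := Finset.exists_min_image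
      (Finset.univ.filter fun e => r e = i) b (by
        obtain ⟨e, he⟩ := hi
        exact ⟨e, by simpa using he⟩)
    simp only [Finset.mem_filter, Finset.mem_univ, true_and] at he₀ hmin
    obtain ⟨e₁, he₁⟩ := hpartner e₀
    have h₀ := hright e₀ he₀
    refine ⟨b e₀, hclosed _ _ e₁ h₀ ?_⟩
    intro e he
    simp only [Finset.mem_Icc, Fin.le_def]
    rw [Fin.le_def] at h₀
    by_cases hee : e = e₀
    · rw [hee, he₀]
      omega
    have h₁ : b e ≠ b e₀ := fun h => hee (he₁ e he h)
    have h₂ := hcol e e₀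
    have h₃ := hcol e₀ e
    have h₄ := hmin e
    have h₅ := hplane e₀ e
    have h₇ := hright e
    unfold Interlaced at h₅
    rw [he₀] at h₃ h₅
    simp only [Ne, Fin.ext_iff, Fin.le_def] at h₁ h₂ h₃ h₄ h₇
    by_cases h₆ : (r e : ℕ) = i
    · omega
    · clear h₄ h₇
      omega

/-- Vectors with pairwise distinct leading positions are independent. -/
theorem card_le_finrank_of_leading {V : Type*} [Fintype V] [LinearOrder V]
    (K : Submodule ℚ (V → ℚ)) (T : Finset V)
    (h : ∀ x ∈ T, ∃ f ∈ K, f x = 1 ∧ ∀ z < x, f z = 0) : T.card ≤ Module.finrank ℚ K := by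
  choose f hf using fun x : T => h x x.2
  have hli : LinearIndependent ℚ fun x : T => (⟨f x, (hf x).1⟩ : K) := by
    rw [Fintype.linearIndependent_iff]
    intro g hg
    by_contra! hne
    obtain ⟨x, hx, hmin⟩ := Finset.exists_min_image
      (Finset.univ.filter fun x => g x ≠ 0) (fun x => (x : V)) (by
        obtain ⟨x, hx⟩ := hne
        exact ⟨x, by simpa using hx⟩)
    simp only [Finset.mem_filter, Finset.mem_univ, true_and] at hx hmin
    have h₁ := congrFun (congrArg Subtype.val hg) (x : V)
    simp only [Submodule.coe_sum, Submodule.coe_smul, Finset.sum_apply, Pi.smul_apply,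
      smul_eq_mul, ZeroMemClass.coe_zero, Pi.zero_apply] at h₁
    rw [Finset.sum_eq_single x, (hf x).2.1, mul_one] at h₁
    · exact hx h₁
    · intro y _ hyx
      by_cases hy : g y = 0
      · rw [hy, zero_mul]
      · rw [(hf y).2.2 x, mul_zero]
        exact lt_of_le_of_ne (hmin y hy) fun h => hyx (Subtype.ext h.symm)
    · simp
  simpa using hli.fintype_card_le_finrank

theorem card_le_finrank_of_trailing {V : Type*} [Fintype V] [LinearOrder V]
    (K : Submodule ℚ (V → ℚ)) (T : Finset V)
    (h : ∀ x ∈ T, ∃ f ∈ K, f x = 1 ∧ ∀ z, x < z → f z = 0) : T.card ≤ Module.finrank ℚ K :=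
  card_le_finrank_of_leading (V := Vᵒᵈ) K T h

/-- The indices after which the color does not change. -/
def monoGaps {m : ℕ} (col : Fin m → Prop) : Finset (Fin m) :=
  Finset.univ.filter fun i => ∃ j : Fin m, (i : ℕ) + 1 = j ∧ (col i ↔ col j)

theorem card_monoGaps_le_of_plane {m : ℕ} (hm : 0 < m) {E : Type*} [Fintype E]
    {r b : E → Fin m} {col : Fin m → Prop}
    (hplane : ∀ e f, ¬ Interlaced (r e) (b e) (r f) (b f))
    (hrc : ∀ e, col (r e)) (hbc : ∀ e, ¬ col (b e))
    (hr : ∀ v, col v → (Finset.univ.filter fun e => r e = v).card = 2)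
    (hb : ∀ v, ¬ col v → (Finset.univ.filter fun e => b e = v).card = 2) :
    (monoGaps col).card + 2 ≤ 2 * Module.finrank ℚ (edgeConst r b) := by
  have hcol : ∀ e f, r e ≠ b f := fun e f h => hbc f (h ▸ hrc e)
  have hr' : ∀ v, Even (Finset.univ.filter fun e => r e = v).card := by
    intro v
    by_cases hv : col v
    · simp [hr v hv]
    · have : ∀ e, r e ≠ v := fun e h => hv (h ▸ hrc e)
      simp [this]
  have hb' : ∀ v, Even (Finset.univ.filter fun e => b e = v).card := by
    intro v
    by_cases hv : col v
    · have : ∀ e, b e ≠ v := fun e h => hbc e (h ▸ hv)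
      simp [this]
    · simp [hb v hv]
  set TL := Finset.univ.filter fun x : Fin m => ∃ y, IsClosedIcc r b x y with hTL
  set TR := Finset.univ.filter fun y : Fin m => ∃ x, IsClosedIcc r b x y with hTR
  have hind : ∀ x y, IsClosedIcc r b x y →
      (fun z => if z ∈ Finset.Icc x y then (1 : ℚ) else 0) ∈ edgeConst r b := by
    intro x y h e
    simp only [h.2 e]
  have hL : TL.card ≤ Module.finrank ℚ (edgeConst r b) := by
    refine card_le_finrank_of_leading _ _ fun x hx => ?_
    obtain ⟨y, hy⟩ := (Finset.mem_filter.1 hx).2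
    refine ⟨_, hind x y hy, by simp [hy.1], fun z hz => ?_⟩
    simp [hz]
  have hR : TR.card ≤ Module.finrank ℚ (edgeConst r b) := by
    refine card_le_finrank_of_trailing _ _ fun y hy => ?_
    obtain ⟨x, hx⟩ := (Finset.mem_filter.1 hy).2
    refine ⟨_, hind x y hx, by simp [hx.1], fun z hz => ?_⟩
    simp [hz]
  let first : Fin m := ⟨0, hm⟩
  let last : Fin m := ⟨m - 1, by omega⟩
  have hall : IsClosedIcc r b first last := by
    refine ⟨by simp [first, Fin.le_def], fun e => ?_⟩
    simp only [Finset.mem_Icc, Fin.le_def, first, last]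
    omega
  have hfirst : first ∈ TL := by simpa [hTL] using ⟨_, hall⟩
  have hlast : last ∈ TR := by simpa [hTR] using ⟨_, hall⟩
  have hsub : monoGaps col ⊆ TR.erase last ∪
      Finset.univ.filter fun i => ∃ j ∈ TL.erase first, (i : ℕ) + 1 = j := by
    intro i hi
    obtain ⟨j, hij, hc⟩ := (Finset.mem_filter.1 hi).2
    have hmain : (∃ x, IsClosedIcc r b x i) ∨ ∃ y, IsClosedIcc r b j y := by
      by_cases hci : col i
      · refine exists_isClosedIcc hplane hcol hr' (fun e => hb _ (hbc e)) hij ?_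
          fun e h => hbc e (h ▸ hc.1 hci)
        have := hr i hci
        obtain ⟨e, he⟩ := Finset.card_pos.1 (by rw [this]; norm_num : 0 < _)
        exact ⟨e, (Finset.mem_filter.1 he).2⟩
      · have hs : ∀ x y, IsClosedIcc b r x y → IsClosedIcc r b x y :=
          fun x y h => ⟨h.1, fun e => (h.2 e).symm⟩
        refine Or.imp (Exists.imp fun x => hs x i) (Exists.imp fun y => hs j y) ?_
        refine exists_isClosedIcc (fun e f h => hplane e f (interlaced_swap.1 h))
          (fun e f h => hcol f e h.symm) hb' (fun e => hr _ (hrc e)) hij ?_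
          fun e h => hci (hc.2 (h ▸ hrc e))
        have := hb i hci
        obtain ⟨e, he⟩ := Finset.card_pos.1 (by rw [this]; norm_num : 0 < _)
        exact ⟨e, (Finset.mem_filter.1 he).2⟩
    rw [Finset.mem_union]
    rcases hmain with h | h
    · left
      rw [Finset.mem_erase]
      refine ⟨fun h => ?_, by simpa [hTR] using h⟩
      have := j.2
      simp only [h, last] at hij
      omega
    · right
      simp only [Finset.mem_filter, Finset.mem_univ, true_and]
      refine ⟨j, Finset.mem_erase.2 ⟨fun h => ?_, by simpa [hTL] using h⟩, hij⟩
      simp [h, first] at hij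
  have hcard : (Finset.univ.filter fun i : Fin m => ∃ j ∈ TL.erase first, (i : ℕ) + 1 = j).card ≤
      (TL.erase first).card := by
    choose! f hf using fun i (hi : i ∈ Finset.univ.filter fun i : Fin m =>
      ∃ j ∈ TL.erase first, (i : ℕ) + 1 = j) => (Finset.mem_filter.1 hi).2
    refine Finset.card_le_card_of_injOn f (fun i hi => (hf i hi).1) fun i hi i' hi' h => ?_
    have h₁ := (hf i hi).2
    have h₂ := (hf i' hi').2
    rw [h] at h₁
    ext
    omega
  have h₁ := (Finset.card_le_card hsub).trans (Finset.card_union_le _ _)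
  have h₂ := Finset.card_erase_of_mem hfirst
  have h₃ := Finset.card_erase_of_mem hlast
  have h₄ := Finset.card_pos.2 ⟨_, hfirst⟩
  have h₅ := Finset.card_pos.2 ⟨_, hlast⟩
  omega

theorem card_monoGaps_le {m : ℕ} (hm : 0 < m) {E : Type*} [Fintype E]
    {r : E → Fin m} {col : Fin m → Prop} (hrc : ∀ e, col (r e))
    (hr : ∀ v, col v → (Finset.univ.filter fun e => r e = v).card = 2)
    (b : E → Fin m) (hbc : ∀ e, ¬ col (b e))
    (hb : ∀ v, ¬ col v → (Finset.univ.filter fun e => b e = v).card = 2) :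
    (monoGaps col).card + 2 ≤ 2 * Module.finrank ℚ (edgeConst r b) + crossPairs r b := by
  induction hX : crossPairs r b using Nat.strong_induction_on generalizing b with
  | _ X ih =>
    by_cases hplane : ∀ e f, ¬ Interlaced (r e) (b e) (r f) (b f)
    · exact (card_monoGaps_le_of_plane hm hplane hrc hbc hr hb).trans (Nat.le_add_right _ _)
    · push Not at hplane
      obtain ⟨e₁, e₂, h⟩ := hplane
      have h₁ := crossPairs_comp_swap r b h
      have h₂ := finrank_edgeConst_comp_swap_le r b e₁ e₂
      have h₃ := ih _ (by omega) (b ∘ Equiv.swap e₁ e₂) (fun e => hbc _) (fun v hv => by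
        rw [← hb v hv]
        refine Finset.card_equiv (Equiv.swap e₁ e₂) fun e => ?_
        simp) rfl
      omega

theorem SegCross.symm {e f : Pt × Pt} (h : SegCross e f) : SegCross f e :=
  Exists.imp (fun _ hx => ⟨hx.2, hx.1⟩) h

theorem SegCross.flip_left {a b : Pt} {f : Pt × Pt} (h : SegCross (a, b) f) :
    SegCross (b, a) f :=
  Exists.imp (fun _ hx => ⟨openSegment_symm ℝ a b ▸ hx.1, hx.2⟩) h

/-- The diagonals of a convex quadrilateral cross. -/
theorem segCross_of_det2_neg {a b c d : Pt} (habc : det2 a b c < 0) (habd : det2 a b d < 0)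
    (hacd : det2 a c d < 0) (hbcd : det2 b c d < 0) : SegCross (a, c) (b, d) := by
  have hsum : det2 a b c + det2 a c d = det2 a b d + det2 b c d := by
    unfold det2; ring
  set D := -(det2 a b c + det2 a c d) with hD
  have hDpos : 0 < D := by linarith
  refine ⟨(-det2 b c d / D) • a + (-det2 a b d / D) • c,
    ⟨_, _, div_pos (by linarith) hDpos, div_pos (by linarith) hDpos, ?_, rfl⟩,
    ⟨-det2 a c d / D, -det2 a b c / D, div_pos (by linarith) hDpos, div_pos (by linarith) hDpos,
      ?_, ?_⟩⟩
  · rw [← add_div, div_eq_one_iff_eq hDpos.ne']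
    linarith
  · rw [← add_div, div_eq_one_iff_eq hDpos.ne']
    linarith
  · ext
    · simp only [Prod.fst_add, Prod.smul_fst, smul_eq_mul, div_mul_eq_mul_div, ← add_div]
      congr 1
      unfold det2
      ring
    · simp only [Prod.snd_add, Prod.smul_snd, smul_eq_mul, div_mul_eq_mul_div, ← add_div]
      congr 1
      unfold det2
      ring

theorem CWList.segCross {m : ℕ} {pt : Fin m → Pt} (h : CWList pt) {a b c d : Fin m}
    (hi : Interlaced a b c d) : SegCross (pt a, pt b) (pt c, pt d) := by
  have key : ∀ {i j k l : Fin m}, i < j → j < k → k < l →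
      SegCross (pt i, pt k) (pt j, pt l) := fun hij hjk hkl =>
    segCross_of_det2_neg (h.2 _ _ _ hij hjk) (h.2 _ _ _ hij (hjk.trans hkl))
      (h.2 _ _ _ (hij.trans hjk) hkl) (h.2 _ _ _ hjk hkl)
  have key₂ : ∀ {a b c d : Fin m}, a < b → c < d → Interlaced a b c d →
      SegCross (pt a, pt b) (pt c, pt d) := by
    intro a b c d hab hcd hi
    unfold Interlaced at hi
    rcases lt_or_ge a c with hac | hac
    · exact key hac (by rw [Fin.lt_def] at *; omega) (by rw [Fin.lt_def] at *; omega)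
    · rw [Fin.le_def] at hac
      exact (key (by rw [Fin.lt_def] at *; omega) (by rw [Fin.lt_def] at *; omega)
        (by rw [Fin.lt_def] at *; omega)).symm
  have key₃ : ∀ {a b c d : Fin m}, a < b → Interlaced a b c d →
      SegCross (pt a, pt b) (pt c, pt d) := by
    intro a b c d hab hi
    rcases lt_trichotomy c d with hcd | rfl | hcd
    · exact key₂ hab hcd hi
    · unfold Interlaced at hi
      omega
    · exact (key₂ hab hcd (by unfold Interlaced at *; omega)).symm.flip_left.symm
  rcases lt_trichotomy a b with hab | rfl | hab
  · exact key₃ hab hi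
  · unfold Interlaced at hi
    omega
  · exact (key₃ hab (by unfold Interlaced at *; omega)).flip_left

/-- The endpoint of color `col` of the edge from `s k` to `s (nx k)`. -/
def colorEnd {m : ℕ} {E : Type*} (col : Fin m → Prop) (s : E ≃ Fin m) (nx : E ≃ E) (k : E) :
    Fin m :=
  if col (s k) then s k else s (nx k)

theorem colorEnd_mem {m : ℕ} {E : Type*} {col : Fin m → Prop} {s : E ≃ Fin m} {nx : E ≃ E}
    (h : ∀ k, col (s (nx k)) ↔ ¬ col (s k)) (k : E) : col (colorEnd col s nx k) := by
  unfold colorEnd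
  split_ifs with hk
  · exact hk
  · exact (h k).2 hk

theorem card_colorEnd_eq {m : ℕ} {E : Type*} [Fintype E] {col : Fin m → Prop} {s : E ≃ Fin m}
    {nx : E ≃ E} (h : ∀ k, col (s (nx k)) ↔ ¬ col (s k)) {v : Fin m} (hv : col v) :
    (Finset.univ.filter fun k => colorEnd col s nx k = v).card = 2 := by
  obtain ⟨k, rfl⟩ := s.surjective v
  obtain ⟨k, rfl⟩ := nx.surjective k
  have hk := (h k).1 hv
  refine Finset.card_eq_two.2 ⟨nx k, k, fun h => hk (h ▸ hv), ?_⟩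
  ext j
  rw [Finset.mem_filter, Finset.mem_insert, Finset.mem_singleton, colorEnd,
    and_iff_right (Finset.mem_univ j)]
  split_ifs with hj
  · rw [s.apply_eq_iff_eq]
    exact ⟨Or.inl, fun h => h.resolve_right fun h => hk (h ▸ hj)⟩
  · rw [s.apply_eq_iff_eq, nx.apply_eq_iff_eq]
    exact ⟨Or.inr, fun h => h.resolve_left fun h => hj (h ▸ hv)⟩

/-- Along a permutation, a predicate is lost as often as it is gained. -/
theorem card_filter_iff_add_two_mul {V : Type*} [Fintype V] (P : V → Prop) (σ : Equiv.Perm V) :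
    (Finset.univ.filter fun v => P v ↔ P (σ v)).card +
      2 * (Finset.univ.filter fun v => P v ∧ ¬ P (σ v)).card = Fintype.card V := by
  have hσ : (Finset.univ.filter fun v => P (σ v)).card = (Finset.univ.filter P).card :=
    Finset.card_equiv σ (by simp)
  rw [← Finset.card_univ, Finset.card_eq_sum_ones Finset.univ]
  simp only [Finset.card_filter] at hσ ⊢
  have h : ∑ v, ((if P v ↔ P (σ v) then 1 else 0) + 2 * (if P v ∧ ¬ P (σ v) then 1 else 0) +
      if P (σ v) then 1 else 0) = ∑ v, (1 + if P v then 1 else 0) := by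
    refine Finset.sum_congr rfl fun v _ => ?_
    by_cases h₁ : P v <;> by_cases h₂ : P (σ v) <;> simp [h₁, h₂]
  simp only [Finset.sum_add_distrib, ← Finset.mul_sum] at h
  omega

theorem cycPred_val_add_one {m : ℕ} (hm : 0 < m) {i : Fin m} (hi : (i : ℕ) ≠ 0) :
    (cycPred hm i : ℕ) + 1 = i := by
  have h₁ : (i : ℕ) + (m - 1) = (i - 1) + m := by omega
  have h₂ : (cycPred hm i : ℕ) = i - 1 := by
    simp only [cycPred]
    rw [h₁, Nat.add_mod_right, Nat.mod_eq_of_lt (by omega)]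
  omega

theorem cycPred_injective {m : ℕ} (hm : 0 < m) : Function.Injective (cycPred hm) := by
  intro i j hij
  have h₁ : (i : ℕ) + (m - 1) ≡ j + (m - 1) [MOD m] := congrArg Fin.val hij
  exact Fin.ext ((h₁.add_right_cancel' _).eq_of_lt_of_lt i.2 j.2)

theorem cycSucc_injective {m : ℕ} (hm : 0 < m) : Function.Injective (cycSucc hm) := by
  intro i j hij
  have h₁ : (i : ℕ) + 1 ≡ j + 1 [MOD m] := congrArg Fin.val hij
  exact Fin.ext ((h₁.add_right_cancel' _).eq_of_lt_of_lt i.2 j.2)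

/-- All but at most one of the monochromatic cyclic gaps are monochromatic linear gaps. -/
theorem card_le_card_monoGaps {m : ℕ} (hm : 0 < m) (col : Fin m → Prop) :
    m ≤ (monoGaps col).card +
      2 * (Finset.univ.filter fun i => col i ∧ ¬ col (cycPred hm i)).card + 1 := by
  have h₁ := card_filter_iff_add_two_mul col
    (Equiv.ofBijective _ (Finite.injective_iff_bijective.1 (cycPred_injective hm)))
  simp only [Equiv.ofBijective_apply, Fintype.card_fin] at h₁
  have h₂ : ((Finset.univ.filter fun i => col i ↔ col (cycPred hm i)).erase ⟨0, hm⟩).card ≤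
      (monoGaps col).card := by
    refine Finset.card_le_card_of_injOn (cycPred hm) (fun i hi => ?_) (cycPred_injective hm).injOn
    have hi := Finset.mem_erase.1 hi
    exact Finset.mem_filter.2 ⟨Finset.mem_univ _, i,
      cycPred_val_add_one hm fun h => hi.1 (Fin.ext h), (Finset.mem_filter.1 hi.2).2.symm⟩
  have h₃ := Finset.pred_card_le_card_erase
    (s := Finset.univ.filter fun i => col i ↔ col (cycPred hm i)) (a := ⟨0, hm⟩)
  omega

theorem runCount_eq {m : ℕ} (hm : 0 < m) {R B : Finset Pt} (hdisj : Disjoint R B)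
    (hB : B.Nonempty) {pt : Fin m → Pt} (hcover : Finset.univ.image pt = R ∪ B)
    {col : Fin m → Prop} (hcol : ∀ i, col i ↔ pt i ∈ R) :
    runCount hm R B pt =
      (Finset.univ.filter fun i => col i ∧ ¬ col (cycPred hm i)).card := by
  have hnot : ∀ i, pt i ∈ B ↔ ¬ col i := fun i => by
    have hmem : pt i ∈ R ∪ B := hcover ▸ Finset.mem_image_of_mem _ (Finset.mem_univ i)
    rw [hcol]
    exact ⟨fun h h' => Finset.disjoint_left.1 hdisj h' h, (Finset.mem_union.1 hmem).resolve_left⟩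
  unfold runCount
  rw [if_neg]
  · congr 1
    ext i
    simp only [Finset.mem_filter, hcol, hnot]
  · intro h
    obtain ⟨x, hx⟩ := hB
    have hx' : x ∈ Finset.univ.image pt := hcover ▸ Finset.mem_union_right _ hx
    obtain ⟨i, -, rfl⟩ := Finset.mem_image.1 hx'
    exact (hnot i).1 hx ((hcol i).2 (h i))

/-- Each unordered crossing pair of edges is counted at most twice. -/
theorem crossPairs_le_two_mul_crossNum {m : ℕ} {es : List (Pt × Pt)}
    {r b : Fin es.length → Fin m}
    (h : ∀ e f, Interlaced (r e) (b e) (r f) (b f) → SegCross es[e] es[f]) :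
    crossPairs r b ≤ 2 * crossNum es := by
  set A := Finset.univ.filter fun p : Fin es.length × Fin es.length =>
    p.1 < p.2 ∧ SegCross es[p.1] es[p.2]
  have hA : A.card ≤ crossNum es := by
    refine Finset.card_le_card_of_injOn (fun p => ((p.1 : ℕ), (p.2 : ℕ))) (fun p hp => ?_)
      fun p _ q _ hpq => ?_
    · have hp := (Finset.mem_filter.1 hp).2
      simp only [Finset.coe_filter, Finset.mem_product, Finset.mem_range, Set.mem_ofPred_eq,
        List.getD_eq_getElem _ _ p.1.2, List.getD_eq_getElem _ _ p.2.2]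
      exact ⟨⟨p.1.2, p.2.2⟩, hp⟩
    · simp only [Prod.mk.injEq] at hpq
      exact Prod.ext (Fin.ext hpq.1) (Fin.ext hpq.2)
  have hB : crossPairs r b = (Finset.univ.filter fun p : Fin es.length × Fin es.length =>
      Interlaced (r p.1) (b p.1) (r p.2) (b p.2)).card := by
    rw [Finset.card_filter, ← Finset.univ_product_univ, Finset.sum_product]
    rfl
  have hsub : (Finset.univ.filter fun p : Fin es.length × Fin es.length =>
      Interlaced (r p.1) (b p.1) (r p.2) (b p.2)) ⊆ A ∪ A.image Prod.swap := by
    rintro ⟨e, f⟩ hp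
    have hp := (Finset.mem_filter.1 hp).2
    rw [Finset.mem_union, Finset.mem_image]
    rcases lt_trichotomy e f with hef | rfl | hef
    · exact Or.inl (Finset.mem_filter.2 ⟨Finset.mem_univ _, hef, h _ _ hp⟩)
    · exact absurd hp (not_interlaced_self _ _)
    · exact Or.inr ⟨(f, e), Finset.mem_filter.2 ⟨Finset.mem_univ _, hef, h _ _ hp.symm⟩, rfl⟩
  have h₁ := (Finset.card_le_card hsub).trans (Finset.card_union_le _ _)
  have h₂ := Finset.card_image_le (s := A) (f := Prod.swap)
  omega

/-- A function that is constant along a Hamiltonian cycle is constant. -/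
theorem finrank_edgeConst_le_one {m N : ℕ} (hN : 0 < N) {r b : Fin N → Fin m} (s : Fin N ≃ Fin m)
    (h : ∀ f ∈ edgeConst r b, ∀ k l : Fin N, (k : ℕ) + 1 = l → f (s l) = f (s k)) :
    Module.finrank ℚ (edgeConst r b) ≤ 1 := by
  refine finrank_le_one (⟨fun _ => 1, fun _ => rfl⟩ : edgeConst r b) fun f =>
    ⟨f.1 (s ⟨0, hN⟩), ?_⟩
  ext v
  have key : ∀ (k : ℕ) (hk : k < N), f.1 (s ⟨k, hk⟩) = f.1 (s ⟨0, hN⟩) := by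
    intro k
    induction k with
    | zero => exact fun _ => rfl
    | succ k ih => exact fun hk => (h f.1 f.2 ⟨k, by omega⟩ ⟨k + 1, hk⟩ rfl).trans (ih _)
  obtain ⟨k, rfl⟩ := s.surjective v
  simpa using (key k k.2).symm

/-- Theorem 3.1(i): for `S = R ∪ B` in convex position (listed clockwise by `pt`) with
`|R| = |B| = n ≥ 2`, every Hamiltonian alternating cycle on `S` has at least
`n − r(S)` crossings. -/
theorem stmt6 (n : ℕ) (hn : 2 ≤ n) (R B : Finset Pt)
    (hdisj : Disjoint R B)
    (hR : R.card = n) (hB : B.card = n)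
    (m : ℕ) (hm : 0 < m) (pt : Fin m → Pt)
    (hcw : CWList pt) (hcover : Finset.univ.image pt = R ∪ B) :
    ∀ C : HamAltCycle R B,
      n - runCount hm R B pt ≤ crossNum (cycleEdges C.verts) := by
  intro C
  have hlen : 0 < C.verts.length := by
    rw [List.length_pos_iff]
    intro h
    have h₁ := C.cover
    rw [h, List.toFinset_nil] at h₁
    have h₂ := Finset.card_le_card (h₁ ▸ Finset.subset_union_left : R ⊆ ∅)
    simp only [Finset.card_empty] at h₂
    omega
  have hes : (cycleEdges C.verts).length = C.verts.length := by
    simp [cycleEdges]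
  have hpt : ∀ k : Fin (cycleEdges C.verts).length,
      ∃ i, pt i = C.verts[(k : ℕ)]'(hes ▸ k.2) := fun k => by
    have h : C.verts[(k : ℕ)]'(hes ▸ k.2) ∈ Finset.univ.image pt := by
      rw [hcover, ← C.cover, List.mem_toFinset]
      exact List.getElem_mem _
    obtain ⟨i, -, hi⟩ := Finset.mem_image.1 h
    exact ⟨i, hi⟩
  choose s₀ hs₀ using hpt
  have hs₀inj : Function.Injective s₀ := fun k l hkl => by
    have h := (hs₀ k).symm.trans ((congrArg pt hkl).trans (hs₀ l))
    exact Fin.ext ((C.nodup.getElem_inj_iff).1 h)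
  have hs₀surj : Function.Surjective s₀ := fun i => by
    have h : pt i ∈ C.verts := by
      rw [← List.mem_toFinset, C.cover, ← hcover]
      exact Finset.mem_image_of_mem _ (Finset.mem_univ i)
    obtain ⟨k, hk, h⟩ := List.getElem_of_mem h
    exact ⟨⟨k, hes ▸ hk⟩, hcw.1 ((hs₀ _).trans h)⟩
  let s := Equiv.ofBijective s₀ ⟨hs₀inj, hs₀surj⟩
  let nx := Equiv.ofBijective _ (Finite.injective_iff_bijective.1
    (cycSucc_injective (hes ▸ hlen : 0 < (cycleEdges C.verts).length)))
  have hedge : ∀ k, (cycleEdges C.verts)[k] = (pt (s k), pt (s (nx k))) := fun k => by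
    change (cycleEdges C.verts)[(k : ℕ)] = (pt (s₀ k), pt (s₀ (cycSucc (hes ▸ hlen) k)))
    rw [hs₀, hs₀]
    simp [cycleEdges, cycSucc, List.getElem_rotate]
  let col : Fin m → Prop := fun i => pt i ∈ R
  have hdis : ∀ {x}, x ∈ R → x ∉ B := fun h h' => Finset.disjoint_left.1 hdisj h h'
  have halt : ∀ k, col (s (nx k)) ↔ ¬ col (s k) := fun k => by
    have h := C.alt _ (List.getElem_mem k.2)
    change Bichromatic R B (cycleEdges C.verts)[k] at h
    rw [hedge] at h
    rcases h with ⟨h₁, h₂⟩ | ⟨h₁, h₂⟩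
    · exact ⟨fun h => absurd h₂ (hdis h), fun h => absurd h₁ h⟩
    · exact ⟨fun _ h => hdis h h₁, fun _ => h₂⟩
  have halt' : ∀ k, ¬ col (s (nx k)) ↔ ¬ ¬ col (s k) := fun k => not_congr (halt k)
  have hends : ∀ k, (colorEnd col s nx k = s k ∧
      colorEnd (fun i => ¬ col i) s nx k = s (nx k)) ∨
      (colorEnd col s nx k = s (nx k) ∧ colorEnd (fun i => ¬ col i) s nx k = s k) := fun k => by
    by_cases h : col (s k) <;> simp [colorEnd, h]
  have hmain := card_monoGaps_le hm (colorEnd_mem halt) (fun v hv => card_colorEnd_eq halt hv)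
    (colorEnd (fun i => ¬ col i) s nx) (colorEnd_mem (col := fun i => ¬ col i) halt')
    (fun v hv => card_colorEnd_eq (col := fun i => ¬ col i) halt' hv)
  have hrank := finrank_edgeConst_le_one (hes ▸ hlen) (r := colorEnd col s nx)
    (b := colorEnd (fun i => ¬ col i) s nx) s fun f hf k l hkl => by
      have hl : nx k = l := Fin.ext (by
        simp only [nx, Equiv.ofBijective_apply, cycSucc, hkl]
        exact Nat.mod_eq_of_lt l.2)
      have h := hf k
      rw [← hl]
      rcases hends k with ⟨h₁, h₂⟩ | ⟨h₁, h₂⟩ <;> rw [h₁, h₂] at h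
      · exact h.symm
      · exact h
  have hcross := crossPairs_le_two_mul_crossNum (r := colorEnd col s nx)
    (b := colorEnd (fun i => ¬ col i) s nx) fun e f h => by
      rw [hedge, hedge]
      apply hcw.segCross
      rcases hends e with ⟨h₁, h₂⟩ | ⟨h₁, h₂⟩ <;> rcases hends f with ⟨h₃, h₄⟩ | ⟨h₃, h₄⟩ <;>
        rw [h₁, h₂, h₃, h₄] at h <;> unfold Interlaced at * <;> omega
  have hgaps := card_le_card_monoGaps hm col
  rw [← runCount_eq hm hdisj (Finset.card_pos.1 (by omega)) hcover fun _ => Iff.rfl] at hgaps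
  have hcard := Finset.card_image_of_injective Finset.univ hcw.1
  rw [hcover, Finset.card_union_of_disjoint hdisj, Finset.card_univ, Fintype.card_fin] at hcard
  omega
end
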